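/- arXiv:1311.1498 — 2 statements merged into one kernel-verified Lean document; each statement's English description precedes it below -/
import Mathlib

section
/- Let f : ℝⁿ → ℝ be a convex C² function with lim sup_{‖x‖→∞} |f(x)|/‖x‖² = 0. Then for every k with 1 ≤ k ≤ n, the infimum over x ∈ ℝⁿ of S_k(Hess f(x)) equals 0; equivalently, for every ε > 0 there exists x₀ ∈ ℝⁿ with 0 ≤ S_k(Hess f(x₀)) ≤ ε^k · C(n,k), where C(n,k) is the binomial coefficient. -/
open scoped RealInnerProductSpace

/-- `S_k(A)`: the `k`-th elementary symmetric function of the eigenvalues of the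
`n × n` real matrix `A`, defined by `det (A + t•I) = ∑_{k=0}^n S_k(A) * t^(n-k)`,
i.e. `S_k(A)` is the coefficient of `t^(n-k)` in the polynomial `det (A + t•I)`. -/
noncomputable def elemSym (n k : ℕ) (A : Matrix (Fin n) (Fin n) ℝ) : ℝ :=
  ((A.map Polynomial.C +
      (Polynomial.X : Polynomial ℝ) • (1 : Matrix (Fin n) (Fin n) (Polynomial ℝ))).det).coeff
    (n - k)

/-- The Hessian matrix `(∂²f/∂x_i∂x_j (x))_{1 ≤ i,j ≤ n}` of `f` at `x`. -/
noncomputable def hessian (n : ℕ) (f : EuclideanSpace ℝ (Fin n) → ℝ)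
    (x : EuclideanSpace ℝ (Fin n)) : Matrix (Fin n) (Fin n) ℝ :=
  Matrix.of fun i j =>
    iteratedFDeriv ℝ 2 f x ![EuclideanSpace.single i 1, EuclideanSpace.single j 1]

/-- Condition (Q): for each `k` with `1 ≤ k ≤ n`, either `a_k ≡ 0` on `ℝⁿ`, or there
are positive constants `μ₁ ≤ μ₂` with `μ₁ ≤ |a_k x| ≤ μ₂` for all `x`. -/
def CondQ {E : Type*} (n : ℕ) (a : ℕ → E → ℝ) : Prop :=
  ∀ k ∈ Finset.Icc 1 n,
    (∀ x, a k x = 0) ∨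
      ∃ μ₁ μ₂ : ℝ, 0 < μ₁ ∧ μ₁ ≤ μ₂ ∧ ∀ x, μ₁ ≤ |a k x| ∧ |a k x| ≤ μ₂

/-- `lim sup_{‖x‖ → ∞} |f x| / ‖x‖² = 0`: since the quantity `|f x| / ‖x‖²` is
nonnegative, this is equivalent to `|f x| / ‖x‖² → 0` as `‖x‖ → ∞`. -/
def QuadDecay (n : ℕ) (f : EuclideanSpace ℝ (Fin n) → ℝ) : Prop :=
  Filter.Tendsto (fun x => |f x| / ‖x‖ ^ 2) (Filter.comap norm Filter.atTop) (nhds 0)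

/-- A function `φ` lying below a parabola that it touches at `0` has second derivative at `0`
at most that of the parabola. -/
theorem second_deriv_le_of_le_parabola {φ φ' : ℝ → ℝ} {a b c : ℝ}
    (hφ : ∀ t, HasDerivAt φ (φ' t) t) (hφ' : HasDerivAt φ' c 0)
    (hle : ∀ t, φ t ≤ φ 0 + a * t + b / 2 * t ^ 2) : c ≤ b := by
  by_contra! hbc
  set ψ : ℝ → ℝ := fun t => φ 0 + a * t + b / 2 * t ^ 2 - φ t with hψ
  have hd (t : ℝ) : HasDerivAt ψ (a + b * t - φ' t) t := by
    have h := ((((hasDerivAt_id t).const_mul a).const_add (φ 0)).add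
      ((hasDerivAt_pow 2 t).const_mul (b / 2))).sub (hφ t)
    refine h.congr_deriv ?_
    push_cast
    ring
  have hderiv : deriv ψ = fun t => a + b * t - φ' t := funext fun t => (hd t).deriv
  have hd2 : HasDerivAt (deriv ψ) (b - c) 0 := by
    rw [hderiv]
    exact ((((hasDerivAt_id (0 : ℝ)).const_mul b).const_add a).sub hφ').congr_deriv (by simp)
  have hmin : IsLocalMin ψ 0 := Filter.Eventually.of_forall fun t => by
    simpa [hψ] using hle t
  have hmax : IsLocalMax ψ 0 :=
    isLocalMax_of_deriv_deriv_neg (by rw [hd2.deriv]; linarith) hmin.deriv_eq_zero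
      (hd 0).continuousAt
  have hconst : ψ =ᶠ[nhds 0] fun _ => ψ 0 := by
    filter_upwards [hmin, hmax] with t h₁ h₂ using le_antisymm h₂ h₁
  have hzero := hconst.deriv.deriv_eq
  rw [hd2.deriv] at hzero
  simp at hzero
  linarith

section SecondDerivative

variable {E : Type*} [NormedAddCommGroup E] [NormedSpace ℝ E] {f : E → ℝ}

theorem hasDerivAt_comp_line (hf : ContDiff ℝ 2 f) (x v : E) (t : ℝ) :
    HasDerivAt (fun s : ℝ => f (x + s • v)) (fderiv ℝ f (x + t • v) v) t := by
  have hline : HasDerivAt (fun s : ℝ => x + s • v) v t := by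
    simpa using ((hasDerivAt_id t).smul_const v).const_add x
  exact ((hf.differentiable (by norm_num)) _).hasFDerivAt.comp_hasDerivAt t hline

theorem hasDerivAt_fderiv_comp_line (hf : ContDiff ℝ 2 f) (x v : E) :
    HasDerivAt (fun s : ℝ => fderiv ℝ f (x + s • v) v) (fderiv ℝ (fderiv ℝ f) x v v) 0 := by
  have hline : HasDerivAt (fun s : ℝ => x + s • v) v 0 := by
    simpa using ((hasDerivAt_id (0 : ℝ)).smul_const v).const_add x
  have hdiff : Differentiable ℝ (fderiv ℝ f) :=
    (hf.fderiv_right (m := 1) (by norm_num)).differentiable (by norm_num)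
  have h := (hdiff (x + (0 : ℝ) • v)).hasFDerivAt.comp_hasDerivAt (0 : ℝ) hline
  simpa using h.clm_apply (hasDerivAt_const (0 : ℝ) v)

theorem ConvexOn.fderiv_fderiv_apply_self_nonneg (hconv : ConvexOn ℝ Set.univ f)
    (hf : ContDiff ℝ 2 f) (x v : E) : 0 ≤ fderiv ℝ (fderiv ℝ f) x v v := by
  have hline : ConvexOn ℝ Set.univ (fun s : ℝ => f (x + s • v)) := by
    have h := hconv.comp_affineMap (AffineMap.lineMap x (x + v) : ℝ →ᵃ[ℝ] E)
    simpa [Function.comp_def, AffineMap.lineMap_apply, add_comm] using h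
  have hmono := hline.monotoneOn_deriv fun t _ => (hasDerivAt_comp_line hf x v t).differentiableAt
  rw [monotoneOn_univ, funext fun t => (hasDerivAt_comp_line hf x v t).deriv] at hmono
  rw [← (hasDerivAt_fderiv_comp_line hf x v).deriv]
  exact hmono.deriv_nonneg

end SecondDerivative

/-- At a maximum point of `f - (ε/2)‖·‖²` the second derivative of `f` is at most `ε‖·‖²`. -/
theorem fderiv_fderiv_apply_self_le_of_forall_le {E : Type*} [NormedAddCommGroup E]
    [InnerProductSpace ℝ E] {f : E → ℝ} (hf : ContDiff ℝ 2 f) {ε : ℝ} {x : E}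
    (hmax : ∀ y, f y - ε / 2 * ‖y‖ ^ 2 ≤ f x - ε / 2 * ‖x‖ ^ 2) (v : E) :
    fderiv ℝ (fderiv ℝ f) x v v ≤ ε * ‖v‖ ^ 2 := by
  refine second_deriv_le_of_le_parabola (a := ε * ⟪x, v⟫) (hasDerivAt_comp_line hf x v)
    (hasDerivAt_fderiv_comp_line hf x v) fun t => ?_
  have h := hmax (x + t • v)
  rw [norm_add_sq_real, inner_smul_right, norm_smul, mul_pow, Real.norm_eq_abs, sq_abs] at h
  simp only [zero_smul, add_zero]
  linarith

theorem QuadDecay.exists_forall_sub_le {n : ℕ} {f : EuclideanSpace ℝ (Fin n) → ℝ}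
    (hgrowth : QuadDecay n f) (hf : Continuous f) {ε : ℝ} (hε : 0 < ε) :
    ∃ x, ∀ y, f y - ε * ‖y‖ ^ 2 ≤ f x - ε * ‖x‖ ^ 2 := by
  refine (show Continuous fun y => f y - ε * ‖y‖ ^ 2 by fun_prop).exists_forall_ge' 0 ?_
  rw [QuadDecay, comap_norm_atTop] at hgrowth
  rw [← Metric.cobounded_eq_cocompact]
  have hsq : Filter.Tendsto (fun y : EuclideanSpace ℝ (Fin n) => ‖y‖ ^ 2)
      (Bornology.cobounded _) Filter.atTop :=
    (Filter.tendsto_pow_atTop two_ne_zero).comp tendsto_norm_cobounded_atTop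
  filter_upwards [hgrowth.eventually_lt_const (half_pos hε), hsq.eventually_gt_atTop 0,
    hsq.eventually_ge_atTop (-f 0 / (ε / 2))] with y h₁ h₂ h₃
  rw [div_lt_iff₀ h₂] at h₁
  rw [div_le_iff₀ (half_pos hε)] at h₃
  have := le_abs_self (f y)
  simp only [norm_zero]
  linarith

theorem isHermitian_hessian {n : ℕ} {f : EuclideanSpace ℝ (Fin n) → ℝ} (hf : ContDiff ℝ 2 f)
    (x : EuclideanSpace ℝ (Fin n)) : (hessian n f x).IsHermitian := by
  ext i j
  have h := hf.contDiffAt.isSymmSndFDerivAt (x := x) (by simp)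
  simpa [hessian, iteratedFDeriv_two_apply] using h.eq _ _

theorem dotProduct_hessian_mulVec {n : ℕ} (f : EuclideanSpace ℝ (Fin n) → ℝ)
    (x v : EuclideanSpace ℝ (Fin n)) :
    dotProduct (⇑v) ((hessian n f x).mulVec ⇑v) = fderiv ℝ (fderiv ℝ f) x v v := by
  have hv : v = ∑ i, v i • EuclideanSpace.single i (1 : ℝ) := by
    simpa using ((EuclideanSpace.basisFun (Fin n) ℝ).sum_repr v).symm
  conv_rhs => rw [hv]
  simp only [map_sum, map_smul, sum_apply, smul_apply,
    smul_eq_mul, dotProduct, Matrix.mulVec, hessian, Matrix.of_apply, iteratedFDeriv_two_apply,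
    Matrix.cons_val_zero, Matrix.cons_val_one, Finset.mul_sum]
  rw [Finset.sum_comm]
  refine Finset.sum_congr rfl fun j _ => Finset.sum_congr rfl fun i _ => ?_
  ring

theorem elemSym_eq_coeff_charpoly_neg (n k : ℕ) (A : Matrix (Fin n) (Fin n) ℝ) :
    elemSym n k A = (-A).charpoly.coeff (n - k) := by
  rw [elemSym, Matrix.charpoly, Matrix.charmatrix]
  congr 2
  ext1 i j
  simp [Matrix.one_apply, Matrix.diagonal_apply, add_comm]

theorem Matrix.IsHermitian.elemSym_eq_sum_prod_eigenvalues {n k : ℕ} (hk : k ≤ n)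
    {A : Matrix (Fin n) (Fin n) ℝ} (hA : (-A).IsHermitian) :
    elemSym n k A = ∑ t ∈ Finset.univ.powersetCard k, ∏ i ∈ t, -hA.eigenvalues i := by
  have h := Finset.prod_X_add_C_coeff Finset.univ (fun i => -hA.eigenvalues i)
    (k := n - k) (by simp)
  rw [Finset.card_univ, Fintype.card_fin, Nat.sub_sub_self hk] at h
  rw [elemSym_eq_coeff_charpoly_neg, hA.charpoly_eq, ← h]
  simp [sub_eq_add_neg]

theorem Matrix.IsHermitian.neg_eigenvalues_neg_eq {n : ℕ} {A : Matrix (Fin n) (Fin n) ℝ}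
    (hA : (-A).IsHermitian) (i : Fin n) :
    -hA.eigenvalues i =
      dotProduct (⇑(hA.eigenvectorBasis i)) (A.mulVec ⇑(hA.eigenvectorBasis i)) := by
  rw [hA.eigenvalues_eq i]
  simp [Matrix.neg_mulVec]

theorem elemSym_nonneg {n k : ℕ} (hk : k ≤ n) {A : Matrix (Fin n) (Fin n) ℝ}
    (hA : A.IsHermitian)
    (hnonneg : ∀ v : EuclideanSpace ℝ (Fin n), 0 ≤ dotProduct (⇑v) (A.mulVec ⇑v)) :
    0 ≤ elemSym n k A := by
  rw [hA.neg.elemSym_eq_sum_prod_eigenvalues hk]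
  refine Finset.sum_nonneg fun t _ => Finset.prod_nonneg fun i _ => ?_
  rw [hA.neg.neg_eigenvalues_neg_eq]
  exact hnonneg _

theorem elemSym_le {n k : ℕ} (hk : k ≤ n) {A : Matrix (Fin n) (Fin n) ℝ}
    (hA : A.IsHermitian) {ε : ℝ}
    (hnonneg : ∀ v : EuclideanSpace ℝ (Fin n), 0 ≤ dotProduct (⇑v) (A.mulVec ⇑v))
    (hle : ∀ v : EuclideanSpace ℝ (Fin n), dotProduct (⇑v) (A.mulVec ⇑v) ≤ ε * ‖v‖ ^ 2) :
    elemSym n k A ≤ ε ^ k * n.choose k := by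
  rw [hA.neg.elemSym_eq_sum_prod_eigenvalues hk]
  calc _ ≤ ∑ t ∈ (Finset.univ : Finset (Fin n)).powersetCard k, ε ^ k := by
        refine Finset.sum_le_sum fun t ht => ?_
        rw [← (Finset.mem_powersetCard.1 ht).2, ← Finset.prod_const]
        refine Finset.prod_le_prod (fun i _ => ?_) fun i _ => ?_ <;>
          rw [hA.neg.neg_eigenvalues_neg_eq]
        · exact hnonneg _
        · simpa [hA.neg.eigenvectorBasis.orthonormal.1 i] using
            hle (hA.neg.eigenvectorBasis i)
    _ = ε ^ k * n.choose k := by simp [mul_comm]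

/-- If `f : ℝⁿ → ℝ` is convex, `C²` and `lim sup_{‖x‖→∞} |f(x)|/‖x‖² = 0`, then for
every `1 ≤ k ≤ n` the infimum of `S_k(Hess f(x))` over `x ∈ ℝⁿ` is `0`; equivalently,
for every `ε > 0` there is `x₀` with `0 ≤ S_k(Hess f(x₀)) ≤ ε^k · C(n,k)`. -/
theorem stmt9 (n : ℕ) (hn : 0 < n)
    (f : EuclideanSpace ℝ (Fin n) → ℝ)
    (hf : ContDiff ℝ 2 f)
    (hconv : ConvexOn ℝ Set.univ f)
    (hgrowth : QuadDecay n f) :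
    ∀ k : ℕ, 1 ≤ k → k ≤ n →
      (⨅ x : EuclideanSpace ℝ (Fin n), elemSym n k (hessian n f x)) = 0 ∧
      ∀ ε : ℝ, 0 < ε → ∃ x₀ : EuclideanSpace ℝ (Fin n),
        0 ≤ elemSym n k (hessian n f x₀) ∧
          elemSym n k (hessian n f x₀) ≤ ε ^ k * (n.choose k) := by
  intro k hk hkn
  have hQnonneg (x v : EuclideanSpace ℝ (Fin n)) :
      0 ≤ dotProduct (⇑v) ((hessian n f x).mulVec ⇑v) := by
    rw [dotProduct_hessian_mulVec]
    exact hconv.fderiv_fderiv_apply_self_nonneg hf x v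
  have hnonneg (x : EuclideanSpace ℝ (Fin n)) : 0 ≤ elemSym n k (hessian n f x) :=
    elemSym_nonneg hkn (isHermitian_hessian hf x) (hQnonneg x)
  have hsmall (ε : ℝ) (hε : 0 < ε) : ∃ x₀ : EuclideanSpace ℝ (Fin n),
      0 ≤ elemSym n k (hessian n f x₀) ∧
        elemSym n k (hessian n f x₀) ≤ ε ^ k * (n.choose k) := by
    obtain ⟨x, hx⟩ := hgrowth.exists_forall_sub_le hf.continuous (half_pos hε)
    refine ⟨x, hnonneg x, elemSym_le hkn (isHermitian_hessian hf x) (hQnonneg x) fun v => ?_⟩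
    rw [dotProduct_hessian_mulVec]
    exact fderiv_fderiv_apply_self_le_of_forall_le hf hx v
  refine ⟨le_antisymm ?_ (Real.iInf_nonneg hnonneg), hsmall⟩
  have hbdd : BddBelow (Set.range fun x => elemSym n k (hessian n f x)) :=
    ⟨0, Set.forall_mem_range.2 hnonneg⟩
  have hlim : Filter.Tendsto (fun ε : ℝ => ε ^ k * (n.choose k)) (nhdsWithin 0 (Set.Ioi 0))
      (nhds 0) := by
    have h : Continuous fun ε : ℝ => ε ^ k * (n.choose k : ℝ) := by fun_prop
    simpa [Nat.one_le_iff_ne_zero.1 hk] using (h.tendsto 0).mono_left nhdsWithin_le_nhds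
  refine ge_of_tendsto hlim ?_
  filter_upwards [self_mem_nhdsWithin] with ε hε
  obtain ⟨x, -, hx⟩ := hsmall ε hε
  exact (ciInf_le hbdd x).trans hx
end

section
/- Let 0 < q < 1 and let α : ℝ → ℝ be a continuous function with q ≤ α(t) ≤ 1/q for all t ∈ ℝ. Define f : ℝⁿ → ℝ by f(x₁,…,xₙ) = Σ_{i=1}^n ∫₀^{x_i} (x_i − t) α(t) dt. Then f is a C² convex function, its Hessian is the diagonal matrix Hess f(x) = diag(α(x₁), …, α(xₙ)), and (q/2)‖x‖² ≤ f(x) ≤ (1/(2q))‖x‖² for all x ∈ ℝⁿ; in particular f has quadratic growth at infinity. -/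
open scoped RealInnerProductSpace

/-- The function `s ↦ ∫₀ˢ (s - t) α(t) dt`, which is the second primitive of `α` vanishing to
first order at `0`. -/
noncomputable def secondPrimitive (α : ℝ → ℝ) (s : ℝ) : ℝ :=
  ∫ t in (0 : ℝ)..s, (s - t) * α t

theorem hasDerivAt_integral_zero {α : ℝ → ℝ} (hα : Continuous α) (s : ℝ) :
    HasDerivAt (fun s => ∫ t in (0 : ℝ)..s, α t) (α s) s :=
  intervalIntegral.integral_hasDerivAt_right (hα.intervalIntegrable _ _)
    hα.aestronglyMeasurable.stronglyMeasurableAtFilter hα.continuousAt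

theorem hasDerivAt_secondPrimitive {α : ℝ → ℝ} (hα : Continuous α) (s : ℝ) :
    HasDerivAt (secondPrimitive α) (∫ t in (0 : ℝ)..s, α t) s := by
  have hid : Continuous fun t => t * α t := continuous_id.mul hα
  have heq : secondPrimitive α =
      fun s => s * (∫ t in (0 : ℝ)..s, α t) - ∫ t in (0 : ℝ)..s, t * α t := by
    funext s
    simp only [secondPrimitive, sub_mul]
    rw [intervalIntegral.integral_sub ((hα.const_mul s).intervalIntegrable _ _)
      (hid.intervalIntegrable _ _), intervalIntegral.integral_const_mul]
  rw [heq]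
  exact (((hasDerivAt_id s).mul (hasDerivAt_integral_zero hα s)).sub
    (hasDerivAt_integral_zero hid s)).congr_deriv (by simp)

theorem deriv_secondPrimitive {α : ℝ → ℝ} (hα : Continuous α) :
    deriv (secondPrimitive α) = fun s => ∫ t in (0 : ℝ)..s, α t :=
  funext fun s => (hasDerivAt_secondPrimitive hα s).deriv

theorem deriv_integral_zero {α : ℝ → ℝ} (hα : Continuous α) :
    deriv (fun s => ∫ t in (0 : ℝ)..s, α t) = α :=
  funext fun s => (hasDerivAt_integral_zero hα s).deriv

theorem contDiff_secondPrimitive {α : ℝ → ℝ} (hα : Continuous α) :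
    ContDiff ℝ 2 (secondPrimitive α) := by
  have hone : ContDiff ℝ 1 fun s => ∫ t in (0 : ℝ)..s, α t := by
    rw [contDiff_one_iff_deriv, deriv_integral_zero hα]
    exact ⟨fun s => (hasDerivAt_integral_zero hα s).differentiableAt, hα⟩
  rw [show (2 : WithTop ℕ∞) = 1 + 1 from one_add_one_eq_two.symm, contDiff_succ_iff_deriv,
    deriv_secondPrimitive hα]
  exact ⟨fun s => (hasDerivAt_secondPrimitive hα s).differentiableAt, by simp, hone⟩

theorem convexOn_secondPrimitive {α : ℝ → ℝ} (hα : Continuous α) (hpos : ∀ t, 0 ≤ α t) :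
    ConvexOn ℝ Set.univ (secondPrimitive α) := by
  refine convexOn_univ_of_deriv2_nonneg
    (fun s => (hasDerivAt_secondPrimitive hα s).differentiableAt) ?_ fun s => ?_
  · rw [deriv_secondPrimitive hα]
    exact fun s => (hasDerivAt_integral_zero hα s).differentiableAt
  · simpa [deriv_secondPrimitive hα, deriv_integral_zero hα] using hpos s

theorem secondPrimitive_mono {α β : ℝ → ℝ} (hα : Continuous α) (hβ : Continuous β)
    (h : ∀ t, α t ≤ β t) (s : ℝ) : secondPrimitive α s ≤ secondPrimitive β s := by
  have hlin : Continuous fun t => s - t := continuous_const.sub continuous_id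
  have hiα := fun a b => (hlin.mul hα).intervalIntegrable (μ := MeasureTheory.volume) a b
  have hiβ := fun a b => (hlin.mul hβ).intervalIntegrable (μ := MeasureTheory.volume) a b
  unfold secondPrimitive
  rcases le_total 0 s with hs | hs
  · exact intervalIntegral.integral_mono_on hs (hiα _ _) (hiβ _ _) fun t ht =>
      mul_le_mul_of_nonneg_left (h t) (sub_nonneg.2 ht.2)
  · rw [intervalIntegral.integral_symm s 0, intervalIntegral.integral_symm s 0, neg_le_neg_iff]
    exact intervalIntegral.integral_mono_on hs (hiβ _ _) (hiα _ _) fun t ht =>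
      mul_le_mul_of_nonpos_left (h t) (sub_nonpos.2 ht.1)

theorem secondPrimitive_const (c s : ℝ) : secondPrimitive (fun _ => c) s = c / 2 * s ^ 2 := by
  simp only [secondPrimitive, intervalIntegral.integral_mul_const]
  rw [intervalIntegral.integral_sub (by simp) (by simp)]
  simp
  ring

section Separable

variable {n : ℕ} {g g' g'' : ℝ → ℝ}

theorem hasFDerivAt_sum_comp_coord (hg : ∀ s, HasDerivAt g (g' s) s)
    (x : EuclideanSpace ℝ (Fin n)) :
    HasFDerivAt (fun x : EuclideanSpace ℝ (Fin n) => ∑ i, g (x i))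
      (∑ i, g' (x i) • (EuclideanSpace.proj i : EuclideanSpace ℝ (Fin n) →L[ℝ] ℝ)) x :=
  HasFDerivAt.fun_sum fun i _ => (hg (x i)).comp_hasFDerivAt x
    (EuclideanSpace.proj i : EuclideanSpace ℝ (Fin n) →L[ℝ] ℝ).hasFDerivAt

/-- The Hessian of a separable function is the diagonal matrix of the second derivatives of its
terms. -/
theorem hessian_sum_comp_coord (hg : ∀ s, HasDerivAt g (g' s) s)
    (hg' : ∀ s, HasDerivAt g' (g'' s) s) (x : EuclideanSpace ℝ (Fin n)) :
    hessian n (fun x => ∑ i, g (x i)) x = Matrix.diagonal fun i => g'' (x i) := by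
  have hfd : fderiv ℝ (fun x : EuclideanSpace ℝ (Fin n) => ∑ i, g (x i)) = fun x =>
      ∑ i, g' (x i) • (EuclideanSpace.proj i : EuclideanSpace ℝ (Fin n) →L[ℝ] ℝ) :=
    funext fun x => (hasFDerivAt_sum_comp_coord hg x).fderiv
  have hsd : HasFDerivAt (fun x : EuclideanSpace ℝ (Fin n) =>
      ∑ i, g' (x i) • (EuclideanSpace.proj i : EuclideanSpace ℝ (Fin n) →L[ℝ] ℝ))
      (∑ i, (g'' (x i) • (EuclideanSpace.proj i : EuclideanSpace ℝ (Fin n) →L[ℝ] ℝ)).smulRight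
        (EuclideanSpace.proj i : EuclideanSpace ℝ (Fin n) →L[ℝ] ℝ)) x :=
    HasFDerivAt.fun_sum fun i _ =>
      HasFDerivAt.smul_const (c := fun x : EuclideanSpace ℝ (Fin n) => g' (x i))
        ((hg' (x i)).comp_hasFDerivAt x
          (EuclideanSpace.proj i : EuclideanSpace ℝ (Fin n) →L[ℝ] ℝ).hasFDerivAt)
        (EuclideanSpace.proj i : EuclideanSpace ℝ (Fin n) →L[ℝ] ℝ)
  ext i j
  rw [hessian, Matrix.of_apply, iteratedFDeriv_two_apply, hfd, hsd.fderiv]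
  simp [Matrix.diagonal_apply]

theorem ConvexOn.sum_comp_coord (hg : ConvexOn ℝ Set.univ g) :
    ConvexOn ℝ Set.univ fun x : EuclideanSpace ℝ (Fin n) => ∑ i, g (x i) := by
  refine ⟨convex_univ, fun x _ y _ a b ha hb hab => ?_⟩
  simp only [smul_eq_mul, Finset.mul_sum, ← Finset.sum_add_distrib]
  exact Finset.sum_le_sum fun i _ => hg.2 (Set.mem_univ (x i)) (Set.mem_univ (y i)) ha hb hab

end Separable

/-- The example of paragraph 4: for `0 < q < 1` and continuous `α` with
`q ≤ α(t) ≤ 1/q`, the function `f(x) = ∑ᵢ ∫₀^{xᵢ} (xᵢ − t) α(t) dt` is `C²`, convex,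
has Hessian `diag(α(x₁), …, α(xₙ))`, and satisfies
`(q/2)‖x‖² ≤ f(x) ≤ (1/(2q))‖x‖²`, so it has quadratic growth at infinity. -/
theorem stmt11 (n : ℕ) (hn : 0 < n)
    (q : ℝ) (hq0 : 0 < q) (hq1 : q < 1)
    (α : ℝ → ℝ) (hαcont : Continuous α)
    (hα : ∀ t, q ≤ α t ∧ α t ≤ 1 / q)
    (f : EuclideanSpace ℝ (Fin n) → ℝ)
    (hfdef : ∀ x : EuclideanSpace ℝ (Fin n),
      f x = ∑ i : Fin n, ∫ t in (0 : ℝ)..(x i), (x i - t) * α t) :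
    ContDiff ℝ 2 f ∧ ConvexOn ℝ Set.univ f ∧
      (∀ x : EuclideanSpace ℝ (Fin n),
        hessian n f x = Matrix.diagonal fun i => α (x i)) ∧
      ∀ x : EuclideanSpace ℝ (Fin n),
        q / 2 * ‖x‖ ^ 2 ≤ f x ∧ f x ≤ 1 / (2 * q) * ‖x‖ ^ 2 := by
  obtain rfl : f = fun x : EuclideanSpace ℝ (Fin n) => ∑ i, secondPrimitive α (x i) :=
    funext hfdef
  have hpos : ∀ t, 0 ≤ α t := fun t => hq0.le.trans (hα t).1
  refine ⟨?_, (convexOn_secondPrimitive hαcont hpos).sum_comp_coord,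
    hessian_sum_comp_coord (hasDerivAt_secondPrimitive hαcont) (hasDerivAt_integral_zero hαcont),
    fun x => ?_⟩
  · exact ContDiff.sum fun i _ => (contDiff_secondPrimitive hαcont).comp
      (EuclideanSpace.proj i : EuclideanSpace ℝ (Fin n) →L[ℝ] ℝ).contDiff
  · rw [EuclideanSpace.real_norm_sq_eq, Finset.mul_sum, Finset.mul_sum]
    constructor <;> refine Finset.sum_le_sum fun i _ => ?_
    · rw [← secondPrimitive_const]
      exact secondPrimitive_mono continuous_const hαcont (fun t => (hα t).1) _
    · rw [show 1 / (2 * q) = 1 / q / 2 by field_simp, ← secondPrimitive_const]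
      exact secondPrimitive_mono hαcont continuous_const (fun t => (hα t).2) _
end
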